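/- Let 𝔽 ∈ {ℝ, ℂ}, let k, m, n be positive integers with k ≤ n, let p ∈ (0,1], and let r > 0 and 0 < L ≤ U be real numbers such that δ := L − U·2^{1/p−1}·(2/r)^{1/p−1/2} > 0. Suppose A ∈ 𝔽^{m×n} satisfies the phaseless bi-Lipschitz condition with constants L, U on the set X := {z ∈ 𝔽^n : ‖z‖₀ ≤ (r+4)k}. Define C̃₂ := U·(2^{1/p−1}/r^{1/p−1/2} + 1)/δ and D̃₂ := 2/δ. Then for every x ∈ 𝔽^n, every η ≥ 0, every e ∈ ℝ^m with ‖e‖₂ ≤ η, and every x♯ ∈ 𝔽^n satisfying both ‖|A x♯| − (|A x| + e)‖₂ ≤ η and ‖x♯‖_p^p ≤ ‖x‖_p^p (in particular, any minimizer of ‖z‖_p over {z ∈ 𝔽^n : ‖|Az| − (|Ax| + e)‖₂ ≤ η}), one has dist(x♯, x) ≤ [ (1 + 2^{1/p−1}/(r/2)^{1/p−1/2})·C̃₂ + 2^{1/p−1}/r^{1/p−1/2} + 1 ]·σ_k(x)_p/k^{1/p−1/2} + (1 + 2^{1/p−1}/(r/2)^{1/p−1/2})·D̃₂·η. -/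

import Mathlib

open MeasureTheory ProbabilityTheory Real Finset

/-- The `ℓ_q` (quasi-)norm `(∑ i, ‖x i‖^q)^{1/q}` of a vector with entries in `𝕜 ∈ {ℝ, ℂ}`. -/
noncomputable def lpNorm {ι : Type*} [Fintype ι] {𝕜 : Type*} [RCLike 𝕜] (q : ℝ) (x : ι → 𝕜) : ℝ :=
  (∑ i, ‖x i‖ ^ q) ^ (1 / q)

open Classical in
/-- The number of nonzero entries of a vector. -/
noncomputable def l0Norm {ι : Type*} [Fintype ι] {𝕜 : Type*} [RCLike 𝕜] (x : ι → 𝕜) : ℕ :=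
  (Finset.univ.filter fun i => x i ≠ 0).card

/-- The phase distance `dist_q(x,y) = inf_{|c|=1} ‖x - c • y‖_q`. -/
noncomputable def phaseDist {ι : Type*} [Fintype ι] {𝕜 : Type*} [RCLike 𝕜] (q : ℝ)
    (x y : ι → 𝕜) : ℝ :=
  sInf {d | ∃ c : 𝕜, ‖c‖ = 1 ∧ d = lpNorm q (fun i => x i - c * y i)}

/-- The best `k`-term approximation error `σ_k(x)_q = inf {‖x - z‖_q : ‖z‖₀ ≤ k}`. -/
noncomputable def sigmaK {ι : Type*} [Fintype ι] {𝕜 : Type*} [RCLike 𝕜] (k : ℕ) (q : ℝ)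
    (x : ι → 𝕜) : ℝ :=
  sInf {d | ∃ z : ι → 𝕜, l0Norm z ≤ k ∧ d = lpNorm q (fun i => x i - z i)}

/-- The entrywise modulus `|Ax|` of the matrix-vector product `Ax`. -/
noncomputable def absMv {m n : ℕ} {𝕜 : Type*} [RCLike 𝕜] (A : Fin m → Fin n → 𝕜)
    (x : Fin n → 𝕜) : Fin m → ℝ :=
  fun i => ‖∑ j, A i j * x j‖

/-- `A` satisfies the phaseless bi-Lipschitz condition on `X` with constants `L, U`:
`L·dist(x,y) ≤ ‖|Ax| - |Ay|‖₂ ≤ U·dist(x,y)` for all `x, y ∈ X`. -/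
def PhaselessBiLip {m n : ℕ} {𝕜 : Type*} [RCLike 𝕜] (A : Fin m → Fin n → 𝕜)
    (X : Set (Fin n → 𝕜)) (L U : ℝ) : Prop :=
  ∀ x ∈ X, ∀ y ∈ X,
    L * phaseDist 2 x y ≤ lpNorm 2 (fun i => absMv A x i - absMv A y i) ∧
    lpNorm 2 (fun i => absMv A x i - absMv A y i) ≤ U * phaseDist 2 x y

theorem exists_top_subset {ι : Type*} [DecidableEq ι] (y : ι → ℝ) (S : Finset ι) (N : ℕ) :
    ∃ T ⊆ S, T.card ≤ N ∧ (∀ i ∈ T, ∀ j ∈ S \ T, y j ≤ y i) ∧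
      ((S \ T).Nonempty → T.card = N) := by
  induction N with
  | zero => exact ⟨∅, by simp, by simp, by simp, by simp⟩
  | succ N ih =>
    obtain ⟨T, hTS, hTN, htop, hcard⟩ := ih
    rcases (S \ T).eq_empty_or_nonempty with h | h
    · exact ⟨T, hTS, by omega, htop, fun h' => absurd h h'.ne_empty⟩
    · obtain ⟨m, hm, hmax⟩ := Finset.exists_max_image (S \ T) y h
      have hm' := Finset.mem_sdiff.1 hm
      have hc : (insert m T).card = N + 1 := by
        rw [Finset.card_insert_of_notMem hm'.2, hcard h]
      refine ⟨insert m T, Finset.insert_subset hm'.1 hTS, hc.le, ?_, fun _ => hc⟩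
      intro i hi j hj
      have hj' : j ∈ S \ T := by
        simp only [Finset.mem_sdiff, Finset.mem_insert, not_or] at hj ⊢
        exact ⟨hj.1, hj.2.2⟩
      rcases Finset.mem_insert.1 hi with rfl | hi
      · exact hmax j hj'
      · exact htop i hi j hj'

theorem l2_le_lp_of_dominated {ι : Type*} {y : ι → ℝ} (hy : ∀ i, 0 ≤ y i) {p : ℝ} (hp0 : 0 < p)
    {N : ℕ} (hN : 0 < N) {T B : Finset ι} (hT : T.card = N) (hB : B.card ≤ N)
    (hTB : ∀ i ∈ T, ∀ j ∈ B, y j ≤ y i) :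
    (∑ i ∈ B, y i ^ (2 : ℝ)) ^ (1 / 2 : ℝ)
      ≤ (N : ℝ) ^ (-(1 / p - 1 / 2)) * (∑ i ∈ T, y i ^ p) ^ (1 / p) := by
  have hN' : (0 : ℝ) < N := by exact_mod_cast hN
  set s := ∑ i ∈ T, y i ^ p with hs
  have hs0 : 0 ≤ s := Finset.sum_nonneg fun i _ => rpow_nonneg (hy i) p
  set M := (s / N) ^ (1 / p) with hM
  have hM0 : 0 ≤ M := by positivity
  have hle : ∀ j ∈ B, y j ≤ M := by
    intro j hj
    have h1 : (N : ℝ) * y j ^ p ≤ s := by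
      have := Finset.card_nsmul_le_sum T (fun i => y i ^ p) (y j ^ p)
        fun i hi => rpow_le_rpow (hy j) (hTB i hi j hj) hp0.le
      rwa [hT, nsmul_eq_mul] at this
    have h2 : y j ^ p ≤ s / N := by rw [le_div_iff₀ hN']; linarith
    calc y j = (y j ^ p) ^ (1 / p) := by
          rw [← rpow_mul (hy j), mul_one_div_cancel hp0.ne', rpow_one]
      _ ≤ M := rpow_le_rpow (rpow_nonneg (hy j) p) h2 (by positivity)
  have hsum : ∑ i ∈ B, y i ^ (2 : ℝ) ≤ N * M ^ (2 : ℝ) := by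
    calc ∑ i ∈ B, y i ^ (2 : ℝ) ≤ B.card • M ^ (2 : ℝ) :=
          Finset.sum_le_card_nsmul _ _ _ fun i hi => rpow_le_rpow (hy i) (hle i hi) (by norm_num)
      _ ≤ N * M ^ (2 : ℝ) := by
          rw [nsmul_eq_mul]
          have : (B.card : ℝ) ≤ N := by exact_mod_cast hB
          gcongr
  calc (∑ i ∈ B, y i ^ (2 : ℝ)) ^ (1 / 2 : ℝ) ≤ (N * M ^ (2 : ℝ)) ^ (1 / 2 : ℝ) :=
        rpow_le_rpow (Finset.sum_nonneg fun i _ => rpow_nonneg (hy i) _) hsum (by norm_num)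
    _ = (N : ℝ) ^ (1 / 2 : ℝ) * M := by
        rw [mul_rpow hN'.le (by positivity), ← rpow_mul hM0]; norm_num
    _ = (N : ℝ) ^ (-(1 / p - 1 / 2)) * s ^ (1 / p) := by
        rw [hM, div_rpow hs0 hN'.le, show -(1 / p - 1 / 2) = (1 / 2 : ℝ) - 1 / p by ring,
          rpow_sub hN']
        ring

theorem tail_le_of_subadditive {ι : Type*} [DecidableEq ι] {y : ι → ℝ} (hy : ∀ i, 0 ≤ y i)
    {p : ℝ} (hp0 : 0 < p) (hp1 : p ≤ 1) {N : ℕ} (hN : 0 < N) {G : Finset ι → ℝ} {U : ℝ}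
    (hU : 0 ≤ U) (hG0 : G ∅ ≤ 0) (hGadd : ∀ B C, Disjoint B C → G (B ∪ C) ≤ G B + G C)
    (hGU : ∀ B : Finset ι, B.card ≤ N → G B ≤ U * (∑ i ∈ B, y i ^ (2 : ℝ)) ^ (1 / 2 : ℝ))
    {S T : Finset ι} (hTS : T ⊆ S) (htop : ∀ i ∈ T, ∀ j ∈ S \ T, y j ≤ y i)
    (hcard : (S \ T).Nonempty → T.card = N) :
    G (S \ T) ≤ U * ((N : ℝ) ^ (-(1 / p - 1 / 2)) * (∑ i ∈ S, y i ^ p) ^ (1 / p)) := by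
  have hsum0 : ∀ B : Finset ι, 0 ≤ ∑ i ∈ B, y i ^ p :=
    fun B => Finset.sum_nonneg fun i _ => rpow_nonneg (hy i) p
  induction S using Finset.strongInduction generalizing T with
  | H S ih =>
    rcases (S \ T).eq_empty_or_nonempty with h | h
    · rw [h]
      have := hsum0 S
      exact hG0.trans (by positivity)
    · have hTN := hcard h
      obtain ⟨T', hT'S, hT'N, htop', hcard'⟩ := exists_top_subset y (S \ T) N
      have hss : S \ T ⊂ S := by
        refine Finset.sdiff_ssubset hTS ?_
        rw [← Finset.card_pos]; omega
      have h1 := ih (S \ T) hss hT'S htop' hcard'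
      have h2 := hGU T' hT'N
      have h3 := hGadd T' ((S \ T) \ T') Finset.disjoint_sdiff
      rw [Finset.union_sdiff_of_subset hT'S] at h3
      have h4 := l2_le_lp_of_dominated hy hp0 hN hTN hT'N
        fun i hi j hj => htop i hi j (hT'S hj)
      have h5 : (∑ i ∈ T, y i ^ p) ^ (1 / p) + (∑ i ∈ S \ T, y i ^ p) ^ (1 / p)
          ≤ (∑ i ∈ S, y i ^ p) ^ (1 / p) := by
        rw [← Finset.sum_sdiff hTS, add_comm (∑ i ∈ S \ T, y i ^ p)]
        exact Real.add_rpow_le_rpow_add (hsum0 _) (hsum0 _) (by rw [le_div_iff₀ hp0]; linarith)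
      have hc : 0 ≤ (N : ℝ) ^ (-(1 / p - 1 / 2)) := by positivity
      calc G (S \ T) ≤ G T' + G ((S \ T) \ T') := h3
        _ ≤ U * ((N : ℝ) ^ (-(1 / p - 1 / 2)) * (∑ i ∈ T, y i ^ p) ^ (1 / p))
            + U * ((N : ℝ) ^ (-(1 / p - 1 / 2)) * (∑ i ∈ S \ T, y i ^ p) ^ (1 / p)) :=
          add_le_add (h2.trans (mul_le_mul_of_nonneg_left h4 hU)) h1
        _ = U * ((N : ℝ) ^ (-(1 / p - 1 / 2)) * ((∑ i ∈ T, y i ^ p) ^ (1 / p)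
            + (∑ i ∈ S \ T, y i ^ p) ^ (1 / p))) := by ring
        _ ≤ _ := by gcongr

theorem lp_le_card_mul_l2 {ι : Type*} {y : ι → ℝ} (hy : ∀ i, 0 ≤ y i) {p : ℝ} (hp0 : 0 < p)
    (hp1 : p ≤ 1) (S : Finset ι) :
    (∑ i ∈ S, y i ^ p) ^ (1 / p)
      ≤ (S.card : ℝ) ^ (1 / p - 1 / 2) * (∑ i ∈ S, y i ^ (2 : ℝ)) ^ (1 / 2 : ℝ) := by
  have hs : 0 ≤ ∑ i ∈ S, y i ^ p := Finset.sum_nonneg fun i _ => rpow_nonneg (hy i) p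
  have h := Real.rpow_sum_le_const_mul_sum_rpow S (fun i => y i ^ p) (p := 2 / p)
    (by rw [le_div_iff₀ hp0]; linarith)
  have h1 : ∀ i, |y i ^ p| = y i ^ p := fun i => abs_of_nonneg (rpow_nonneg (hy i) p)
  have h2 : ∀ i, (y i ^ p) ^ (2 / p) = y i ^ (2 : ℝ) := fun i => by
    rw [← rpow_mul (hy i), mul_div_cancel₀ _ hp0.ne']
  simp only [h1, h2] at h
  have h3 := rpow_le_rpow (by positivity) h (by norm_num : (0 : ℝ) ≤ 1 / 2)
  rw [mul_rpow (by positivity) (Finset.sum_nonneg fun i _ => rpow_nonneg (hy i) _), ← rpow_mul hs,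
    ← rpow_mul (by positivity)] at h3
  convert h3 using 2 <;> ring_nf

theorem add_rpow_one_div_le {a b p : ℝ} (ha : 0 ≤ a) (hb : 0 ≤ b) (hp0 : 0 < p) (hp1 : p ≤ 1) :
    (a + b) ^ (1 / p) ≤ 2 ^ (1 / p - 1) * (a ^ (1 / p) + b ^ (1 / p)) := by
  have h := Real.rpow_sum_le_const_mul_sum_rpow (Finset.univ : Finset (Fin 2)) ![a, b] (p := 1 / p)
    (by rw [le_div_iff₀ hp0]; linarith)
  simpa [Fin.sum_univ_two, abs_of_nonneg ha, abs_of_nonneg hb] using h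

theorem lpNorm_entries_nonneg {ι : Type*} [Fintype ι] {𝕜 : Type*} [RCLike 𝕜] (q : ℝ)
    (x : ι → 𝕜) :
    0 ≤ _root_.lpNorm q x :=
  rpow_nonneg (Finset.sum_nonneg fun _ _ => rpow_nonneg (norm_nonneg _) _) _

theorem lpNorm_rpow {ι : Type*} [Fintype ι] {𝕜 : Type*} [RCLike 𝕜] {q : ℝ} (hq : 0 < q)
    (x : ι → 𝕜) : _root_.lpNorm q x ^ q = ∑ i, ‖x i‖ ^ q := by
  rw [_root_.lpNorm, ← rpow_mul (Finset.sum_nonneg fun i _ => rpow_nonneg (norm_nonneg _) _),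
    one_div_mul_cancel hq.ne', rpow_one]

theorem lpNorm_mono {ι : Type*} [Fintype ι] {𝕜 𝕜' : Type*} [RCLike 𝕜] [RCLike 𝕜'] {q : ℝ}
    (hq : 0 < q) {x : ι → 𝕜} {y : ι → 𝕜'} (h : ∀ i, ‖x i‖ ≤ ‖y i‖) :
    _root_.lpNorm q x ≤ _root_.lpNorm q y :=
  rpow_le_rpow (Finset.sum_nonneg fun i _ => rpow_nonneg (norm_nonneg _) _)
    (Finset.sum_le_sum fun i _ => rpow_le_rpow (norm_nonneg _) (h i) hq.le) (by positivity)

theorem lpNorm_two_eq_norm {ι : Type*} [Fintype ι] {𝕜 : Type*} [RCLike 𝕜] (x : ι → 𝕜) :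
    _root_.lpNorm 2 x = ‖WithLp.toLp 2 x‖ := by
  simp [_root_.lpNorm, EuclideanSpace.norm_eq, Real.sqrt_eq_rpow]

theorem lpNorm_two_add_le {ι : Type*} [Fintype ι] {𝕜 : Type*} [RCLike 𝕜] (x y : ι → 𝕜) :
    _root_.lpNorm 2 (fun i => x i + y i) ≤ _root_.lpNorm 2 x + _root_.lpNorm 2 y := by
  simp only [lpNorm_two_eq_norm]
  exact norm_add_le (WithLp.toLp 2 x) (WithLp.toLp 2 y)

/-- The restriction of a vector to a set of coordinates, extended by zero. -/
def restrictTo {ι : Type*} [DecidableEq ι] {𝕜 : Type*} [RCLike 𝕜] (S : Finset ι) (x : ι → 𝕜) :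
    ι → 𝕜 :=
  fun i => if i ∈ S then x i else 0

theorem lpNorm_restrictTo {ι : Type*} [Fintype ι] [DecidableEq ι] {𝕜 : Type*} [RCLike 𝕜] {q : ℝ}
    (hq : 0 < q) (S : Finset ι) (x : ι → 𝕜) :
    _root_.lpNorm q (restrictTo S x) = (∑ i ∈ S, ‖x i‖ ^ q) ^ (1 / q) := by
  have h : ∀ i, ‖restrictTo S x i‖ ^ q = if i ∈ S then ‖x i‖ ^ q else 0 := by
    intro i
    by_cases hi : i ∈ S <;> simp [restrictTo, hi, hq.ne']
  simp only [_root_.lpNorm, h, Finset.sum_ite_mem, Finset.univ_inter]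

theorem l0Norm_restrictTo_le {ι : Type*} [Fintype ι] [DecidableEq ι] {𝕜 : Type*} [RCLike 𝕜]
    (S : Finset ι) (x : ι → 𝕜) : l0Norm (restrictTo S x) ≤ S.card := by
  refine Finset.card_le_card fun i hi => ?_
  by_contra h
  simp [restrictTo, h] at hi

theorem lpNorm_absMv_sub_le {m n : ℕ} {𝕜 : Type*} [RCLike 𝕜] (A : Fin m → Fin n → 𝕜)
    (u v : Fin n → 𝕜) :
    _root_.lpNorm 2 (fun i => absMv A u i - absMv A v i)
      ≤ _root_.lpNorm 2 (absMv A (fun j => u j - v j)) := by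
  refine lpNorm_mono two_pos fun i => ?_
  simp only [absMv, mul_sub, Finset.sum_sub_distrib, norm_norm]
  exact abs_norm_sub_norm_le _ _

theorem lpNorm_absMv_add_le {m n : ℕ} {𝕜 : Type*} [RCLike 𝕜] (A : Fin m → Fin n → 𝕜)
    (u v : Fin n → 𝕜) :
    _root_.lpNorm 2 (absMv A (fun j => u j + v j))
      ≤ _root_.lpNorm 2 (absMv A u) + _root_.lpNorm 2 (absMv A v) := by
  refine le_trans (lpNorm_mono two_pos fun i => ?_) (lpNorm_two_add_le _ _)
  simp only [absMv, mul_add, Finset.sum_add_distrib, norm_norm]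
  exact (norm_add_le _ _).trans (le_abs_self _)

theorem phaseDist_le {ι : Type*} [Fintype ι] {𝕜 : Type*} [RCLike 𝕜] (q : ℝ) (x y : ι → 𝕜) {c : 𝕜}
    (hc : ‖c‖ = 1) : phaseDist q x y ≤ _root_.lpNorm q (fun i => x i - c * y i) :=
  csInf_le ⟨0, by rintro _ ⟨c, -, rfl⟩; exact lpNorm_entries_nonneg _ _⟩ ⟨c, hc, rfl⟩

theorem exists_phaseDist_two_eq {ι : Type*} [Fintype ι] {𝕜 : Type*} [RCLike 𝕜] (x y : ι → 𝕜) :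
    ∃ c : 𝕜, ‖c‖ = 1 ∧ phaseDist 2 x y = _root_.lpNorm 2 (fun i => x i - c * y i) := by
  have hcont : Continuous fun c : 𝕜 => _root_.lpNorm 2 (fun i => x i - c * y i) := by
    simp only [lpNorm_two_eq_norm]
    fun_prop
  obtain ⟨c, hc, hmin⟩ := (isCompact_sphere (0 : 𝕜) 1).exists_isMinOn
    ⟨1, by simp⟩ hcont.continuousOn
  have hc' : ‖c‖ = 1 := by simpa using hc
  refine ⟨c, hc', le_antisymm (phaseDist_le 2 x y hc') (le_csInf ⟨_, c, hc', rfl⟩ ?_)⟩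
  rintro _ ⟨d, hd, rfl⟩
  exact hmin (by simpa using hd)

theorem exists_restrict_compl_le_sigmaK {ι : Type*} [Fintype ι] [DecidableEq ι] {𝕜 : Type*}
    [RCLike 𝕜] (k : ℕ) {p : ℝ} (hp0 : 0 < p) (x : ι → 𝕜) :
    ∃ T : Finset ι, T.card ≤ k ∧ (∑ i ∈ Tᶜ, ‖x i‖ ^ p) ^ (1 / p) ≤ sigmaK k p x := by
  classical
  obtain ⟨T, hT, hmin⟩ := Finset.exists_min_image
    (Finset.univ.filter fun T : Finset ι => T.card ≤ k) (fun T => ∑ i ∈ Tᶜ, ‖x i‖ ^ p)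
    ⟨∅, by simp⟩
  simp only [Finset.mem_filter, Finset.mem_univ, true_and] at hT hmin
  refine ⟨T, hT, le_csInf ⟨_, 0, by simp [l0Norm], rfl⟩ ?_⟩
  rintro _ ⟨z, hz, rfl⟩
  refine rpow_le_rpow (Finset.sum_nonneg fun i _ => rpow_nonneg (norm_nonneg _) _) ?_
    (by positivity)
  refine (hmin (Finset.univ.filter fun i => z i ≠ 0) (by unfold l0Norm at hz; convert hz)).trans ?_
  calc ∑ i ∈ (Finset.univ.filter fun i => z i ≠ 0)ᶜ, ‖x i‖ ^ p
      = ∑ i ∈ (Finset.univ.filter fun i => z i ≠ 0)ᶜ, ‖x i - z i‖ ^ p :=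
        Finset.sum_congr rfl fun i hi => by
          have : z i = 0 := by simpa using hi
          rw [this, sub_zero]
    _ ≤ ∑ i, ‖x i - z i‖ ^ p :=
        Finset.sum_le_sum_of_subset_of_nonneg (Finset.subset_univ _)
          fun i _ _ => rpow_nonneg (norm_nonneg _) _

theorem PhaselessBiLip.lpNorm_absMv_le {m n : ℕ} {𝕜 : Type*} [RCLike 𝕜] {A : Fin m → Fin n → 𝕜}
    {s L U : ℝ} (hs : 0 ≤ s) (hU : 0 ≤ U)
    (hA : PhaselessBiLip A {z | (l0Norm z : ℝ) ≤ s} L U) {z : Fin n → 𝕜}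
    (hz : (l0Norm z : ℝ) ≤ s) : _root_.lpNorm 2 (absMv A z) ≤ U * _root_.lpNorm 2 z := by
  have h := (hA z hz 0 (by simpa [l0Norm] using hs)).2
  have h0 : ∀ i, absMv A 0 i = 0 := by simp [absMv]
  simp only [h0, sub_zero] at h
  have h1 := phaseDist_le 2 z 0 (c := (1 : 𝕜)) (by simp)
  simp only [Pi.zero_apply, mul_zero, sub_zero] at h1
  exact h.trans (mul_le_mul_of_nonneg_left h1 hU)

theorem lpNorm_restrictTo_tail_le {ι : Type*} [Fintype ι] [DecidableEq ι] {𝕜 : Type*} [RCLike 𝕜]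
    {p : ℝ} (hp0 : 0 < p) (hp1 : p ≤ 1) {N : ℕ} (hN : 0 < N) {z : ι → 𝕜} {F : (ι → 𝕜) → ℝ} {U : ℝ}
    (hU : 0 ≤ U) (hF0 : F 0 ≤ 0) (hFadd : ∀ u v, F (fun i => u i + v i) ≤ F u + F v)
    (hFU : ∀ u, l0Norm u ≤ N → F u ≤ U * _root_.lpNorm 2 u)
    {S T : Finset ι} (hTS : T ⊆ S) (htop : ∀ i ∈ T, ∀ j ∈ S \ T, ‖z j‖ ≤ ‖z i‖)
    (hcard : (S \ T).Nonempty → T.card = N) :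
    F (restrictTo (S \ T) z)
      ≤ U * ((N : ℝ) ^ (-(1 / p - 1 / 2)) * (∑ i ∈ S, ‖z i‖ ^ p) ^ (1 / p)) := by
  refine tail_le_of_subadditive (y := fun i => ‖z i‖) (fun i => norm_nonneg _) hp0 hp1 hN
    (G := fun B => F (restrictTo B z)) hU ?_ ?_ ?_ hTS htop hcard
  · have : restrictTo ∅ z = 0 := by ext i; simp [restrictTo]
    simpa only [this] using hF0
  · intro B C hBC
    have : restrictTo (B ∪ C) z = fun i => restrictTo B z i + restrictTo C z i := by
      ext i
      have hi : i ∈ B → i ∉ C := fun h => Finset.disjoint_left.1 hBC h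
      by_cases hB : i ∈ B <;> by_cases hC : i ∈ C <;> simp_all [restrictTo]
    simpa only [this] using hFadd _ _
  · intro B hB
    rw [← lpNorm_restrictTo two_pos]
    exact hFU _ ((l0Norm_restrictTo_le B z).trans hB)

theorem lp_tail_le {ι : Type*} [Fintype ι] [DecidableEq ι] {𝕜 : Type*} [RCLike 𝕜] {p : ℝ}
    (hp0 : 0 < p) (hp1 : p ≤ 1) {x xs : ι → 𝕜} {c : 𝕜} (hc : ‖c‖ = 1)
    (hmin : _root_.lpNorm p xs ^ p ≤ _root_.lpNorm p x ^ p) (T : Finset ι) :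
    ∑ i ∈ Tᶜ, ‖xs i‖ ^ p ≤ ∑ i ∈ T, ‖xs i - c * x i‖ ^ p + ∑ i ∈ Tᶜ, ‖x i‖ ^ p := by
  rw [lpNorm_rpow hp0, lpNorm_rpow hp0, ← Finset.sum_add_sum_compl T,
    ← Finset.sum_add_sum_compl T] at hmin
  have h : ∑ i ∈ T, ‖x i‖ ^ p ≤ ∑ i ∈ T, ‖xs i - c * x i‖ ^ p + ∑ i ∈ T, ‖xs i‖ ^ p := by
    rw [← Finset.sum_add_distrib]
    refine Finset.sum_le_sum fun i _ => ?_
    have h1 : ‖x i‖ ≤ ‖xs i - c * x i‖ + ‖xs i‖ := by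
      calc ‖x i‖ = ‖c * x i‖ := by rw [norm_mul, hc, one_mul]
        _ ≤ ‖xs i - c * x i‖ + ‖xs i‖ := by
          rw [norm_sub_rev]
          exact (norm_le_norm_add_norm_sub' _ (xs i)).trans (add_comm _ _).le
    exact (rpow_le_rpow (norm_nonneg _) h1 hp0.le).trans
      (Real.rpow_add_le_add_rpow (norm_nonneg _) (norm_nonneg _) hp0.le hp1)
  linarith

/-- Theorem `th:main11`, the `dist₂` bound: under the phaseless bi-Lipschitz
condition on `(r+4)k`-sparse vectors, any feasible `ℓ_p`-minimizer `x♯` satisfies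
`dist(x♯,x) ≤ [(1 + 2^{1/p-1}/(r/2)^{1/p-1/2})·C̃₂ + 2^{1/p-1}/r^{1/p-1/2} + 1]·σ_k(x)_p/k^{1/p-1/2}
+ (1 + 2^{1/p-1}/(r/2)^{1/p-1/2})·D̃₂·η`. -/
theorem stmt1 {𝕜 : Type*} [RCLike 𝕜] (k m n : ℕ) (hk : 0 < k) (hm : 0 < m) (hn : 0 < n)
    (hkn : k ≤ n) (p : ℝ) (hp0 : 0 < p) (hp1 : p ≤ 1)
    (r L U : ℝ) (hr : 0 < r) (hL : 0 < L) (hLU : L ≤ U)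
    (δ : ℝ) (hδdef : δ = L - U * 2 ^ (1 / p - 1) * (2 / r) ^ (1 / p - 1 / 2)) (hδ : 0 < δ)
    (A : Fin m → Fin n → 𝕜)
    (hA : PhaselessBiLip A {z | (l0Norm z : ℝ) ≤ (r + 4) * k} L U)
    (C₂ D₂ : ℝ)
    (hC₂ : C₂ = U * (2 ^ (1 / p - 1) / r ^ (1 / p - 1 / 2) + 1) / δ)
    (hD₂ : D₂ = 2 / δ)
    (x xs : Fin n → 𝕜) (η : ℝ) (hη : 0 ≤ η) (e : Fin m → ℝ) (he : lpNorm 2 e ≤ η)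
    (hfeas : lpNorm 2 (fun i => absMv A xs i - (absMv A x i + e i)) ≤ η)
    (hmin : lpNorm p xs ^ p ≤ lpNorm p x ^ p) :
    phaseDist 2 xs x ≤
      ((1 + 2 ^ (1 / p - 1) / (r / 2) ^ (1 / p - 1 / 2)) * C₂
          + 2 ^ (1 / p - 1) / r ^ (1 / p - 1 / 2) + 1) * sigmaK k p x / (k : ℝ) ^ (1 / p - 1 / 2)
        + (1 + 2 ^ (1 / p - 1) / (r / 2) ^ (1 / p - 1 / 2)) * D₂ * η := by
  classical
  have hU : 0 < U := hL.trans_le hLU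
  have hk' : (0 : ℝ) < k := by exact_mod_cast hk
  have hk1 : (1 : ℝ) ≤ k := by exact_mod_cast hk
  have hs : 0 ≤ (r + 4) * (k : ℝ) := by positivity
  obtain ⟨a, ha⟩ : ∃ a, a = 1 / p - 1 / 2 := ⟨_, rfl⟩
  have ha0 : 0 < a := by
    have : 1 ≤ 1 / p := by rw [le_div_iff₀ hp0]; linarith
    rw [ha]; linarith
  obtain ⟨Q, hQ⟩ : ∃ Q : ℝ, Q = 2 ^ (1 / p - 1) := ⟨_, rfl⟩
  have hQ0 : 0 < Q := by rw [hQ]; positivity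
  -- the block length for the tail of `xs`
  obtain ⟨N, hN⟩ : ∃ N : ℕ, N = ⌈r * k⌉₊ := ⟨_, rfl⟩
  have hN0 : 0 < N := by rw [hN, Nat.ceil_pos]; positivity
  have hNge : r * k ≤ N := by rw [hN]; exact Nat.le_ceil _
  have hNle : (N : ℝ) ≤ r * k + 1 := by
    rw [hN]; exact (Nat.ceil_lt_add_one (by positivity)).le
  -- the support of the head of `x`
  obtain ⟨T₀, hT₀, hσ⟩ := exists_restrict_compl_le_sigmaK k hp0 x
  obtain ⟨T₁, hT₁S, hT₁, htop₁, hcard₁⟩ := exists_top_subset (fun i => ‖x i‖) T₀ᶜ k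
  obtain ⟨S, hS⟩ : ∃ S, S = T₀ ∪ T₁ := ⟨_, rfl⟩
  have hScard : S.card ≤ 2 * k := by
    rw [hS]; have := Finset.card_union_le T₀ T₁; omega
  have hSc : T₀ᶜ \ T₁ = Sᶜ := by
    ext i; simp [hS]
  rw [hSc] at htop₁ hcard₁
  obtain ⟨T₂, hT₂S, hT₂, htop₂, hcard₂⟩ := exists_top_subset (fun i => ‖xs i‖) Sᶜ N
  obtain ⟨V, hV⟩ : ∃ V, V = S ∪ T₂ := ⟨_, rfl⟩
  have hSV : S ⊆ V := hV ▸ Finset.subset_union_left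
  have hVc : Sᶜ \ T₂ = Vᶜ := by
    ext i; simp [hV]
  have hVcard : (V.card : ℝ) ≤ (r + 4) * k := by
    have h1 : V.card ≤ 2 * k + N := by
      rw [hV]; exact (Finset.card_union_le S T₂).trans (by omega)
    have h2 : (V.card : ℝ) ≤ 2 * k + N := by exact_mod_cast h1
    nlinarith
  have hSmem : (l0Norm (restrictTo S x) : ℝ) ≤ (r + 4) * k := by
    have h1 : (l0Norm (restrictTo S x) : ℝ) ≤ V.card := by
      exact_mod_cast (l0Norm_restrictTo_le S x).trans (Finset.card_le_card hSV)
    exact h1.trans hVcard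
  have hVmem : (l0Norm (restrictTo V xs) : ℝ) ≤ (r + 4) * k :=
    le_trans (by exact_mod_cast l0Norm_restrictTo_le V xs) hVcard
  -- the measurement and Euclidean norms as subadditive functionals
  have hmeas0 : _root_.lpNorm 2 (absMv A 0) ≤ 0 := by
    simp [_root_.lpNorm, absMv]
  have htwo0 : _root_.lpNorm 2 (0 : Fin n → 𝕜) ≤ 0 := by
    simp [_root_.lpNorm]
  have hmeasU : ∀ M : ℕ, (M : ℝ) ≤ (r + 4) * k → ∀ u : Fin n → 𝕜, l0Norm u ≤ M →
      _root_.lpNorm 2 (absMv A u) ≤ U * _root_.lpNorm 2 u := fun M hM u hu =>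
    hA.lpNorm_absMv_le hs hU.le (le_trans (by exact_mod_cast hu) hM)
  have hkM : (k : ℝ) ≤ (r + 4) * k := by nlinarith
  have hNM : (N : ℝ) ≤ (r + 4) * k := by nlinarith
  obtain ⟨σ, hσdef⟩ : ∃ σ, σ = sigmaK k p x := ⟨_, rfl⟩
  rw [← hσdef] at hσ
  have hpsum : ∀ (B : Finset (Fin n)) (z : Fin n → 𝕜), 0 ≤ ∑ i ∈ B, ‖z i‖ ^ p :=
    fun B z => Finset.sum_nonneg fun i _ => rpow_nonneg (norm_nonneg _) _
  have hσ0 : 0 ≤ σ := le_trans (rpow_nonneg (hpsum _ _) _) hσ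
  obtain ⟨τ, hτ⟩ : ∃ τ, τ = (k : ℝ) ^ (-a) * σ := ⟨_, rfl⟩
  have hτ' : τ = σ / (k : ℝ) ^ a := by rw [hτ, rpow_neg hk'.le]; field_simp
  have hxle : (k : ℝ) ^ (-(1 / p - 1 / 2)) * (∑ i ∈ T₀ᶜ, ‖x i‖ ^ p) ^ (1 / p) ≤ τ := by
    rw [hτ, ← ha]; gcongr
  have hx2 : _root_.lpNorm 2 (restrictTo Sᶜ x) ≤ τ := by
    have := lpNorm_restrictTo_tail_le hp0 hp1 hk (z := x) (F := _root_.lpNorm 2) zero_le_one htwo0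
      lpNorm_two_add_le (fun u _ => (one_mul _).ge) hT₁S (by rwa [hSc]) (by rwa [hSc])
    rw [hSc, one_mul] at this
    exact this.trans hxle
  have hxA : _root_.lpNorm 2 (absMv A (restrictTo Sᶜ x)) ≤ U * τ := by
    have := lpNorm_restrictTo_tail_le hp0 hp1 hk (z := x)
      (F := fun u => _root_.lpNorm 2 (absMv A u)) hU.le hmeas0
      (lpNorm_absMv_add_le A) (hmeasU k hkM) hT₁S (by rwa [hSc]) (by rwa [hSc])
    rw [hSc] at this
    exact this.trans (mul_le_mul_of_nonneg_left hxle hU.le)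
  -- the phase aligning the two heads
  obtain ⟨c, hc, hdist⟩ := exists_phaseDist_two_eq (restrictTo V xs) (restrictTo S x)
  obtain ⟨H, hH⟩ : ∃ H, H = phaseDist 2 (restrictTo V xs) (restrictTo S x) := ⟨_, rfl⟩
  have hH0 : 0 ≤ H := by rw [hH, hdist]; exact lpNorm_entries_nonneg _ _
  have hhead : (∑ i ∈ S, ‖xs i - c * x i‖ ^ (2 : ℝ)) ^ (1 / 2 : ℝ) ≤ H := by
    rw [← lpNorm_restrictTo two_pos S (fun i => xs i - c * x i), hH, hdist]
    refine lpNorm_mono two_pos fun i => ?_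
    by_cases hi : i ∈ S
    · simp [restrictTo, hi, hSV hi]
    · simp [restrictTo, hi]
  have hcone : (∑ i ∈ Sᶜ, ‖xs i‖ ^ p) ^ (1 / p) ≤ Q * ((2 * k : ℝ) ^ a * H + σ) := by
    have h1 := lp_tail_le hp0 hp1 hc hmin S
    have h2 : (∑ i ∈ Sᶜ, ‖x i‖ ^ p) ^ (1 / p) ≤ σ := by
      refine le_trans (rpow_le_rpow (hpsum _ _) (Finset.sum_le_sum_of_subset_of_nonneg ?_
        fun i _ _ => rpow_nonneg (norm_nonneg _) _) (by positivity)) hσ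
      rw [← hSc]; exact Finset.sdiff_subset
    have h3 := lp_le_card_mul_l2 (y := fun i => ‖xs i - c * x i‖) (fun i => norm_nonneg _)
      hp0 hp1 S
    have h4 : ((S.card : ℝ)) ^ a ≤ (2 * k : ℝ) ^ a :=
      rpow_le_rpow (by positivity) (by exact_mod_cast hScard) ha0.le
    rw [← ha] at h3
    calc (∑ i ∈ Sᶜ, ‖xs i‖ ^ p) ^ (1 / p)
        ≤ (∑ i ∈ S, ‖xs i - c * x i‖ ^ p + ∑ i ∈ Sᶜ, ‖x i‖ ^ p) ^ (1 / p) :=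
          rpow_le_rpow (hpsum _ _) h1 (by positivity)
      _ ≤ Q * ((∑ i ∈ S, ‖xs i - c * x i‖ ^ p) ^ (1 / p)
            + (∑ i ∈ Sᶜ, ‖x i‖ ^ p) ^ (1 / p)) :=
          hQ ▸ add_rpow_one_div_le (hpsum _ fun i => xs i - c * x i) (hpsum _ _) hp0 hp1
      _ ≤ Q * ((2 * k : ℝ) ^ a * H + σ) := by
          gcongr
          exact h3.trans (mul_le_mul h4 hhead (rpow_nonneg (Finset.sum_nonneg fun i _ =>
            rpow_nonneg (norm_nonneg _) _) _) (by positivity))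
  obtain ⟨θ, hθ⟩ : ∃ θ, θ = Q * (2 / r) ^ a * H + Q / r ^ a * τ := ⟨_, rfl⟩
  have hxsle : (N : ℝ) ^ (-(1 / p - 1 / 2)) * (∑ i ∈ Sᶜ, ‖xs i‖ ^ p) ^ (1 / p) ≤ θ := by
    rw [← ha]
    have h1 : (N : ℝ) ^ (-a) ≤ (r * k) ^ (-a) :=
      rpow_le_rpow_of_nonpos (by positivity) hNge (by linarith)
    calc (N : ℝ) ^ (-a) * (∑ i ∈ Sᶜ, ‖xs i‖ ^ p) ^ (1 / p)
        ≤ (r * k) ^ (-a) * (Q * ((2 * k : ℝ) ^ a * H + σ)) :=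
          mul_le_mul h1 hcone (rpow_nonneg (hpsum _ _) _) (by positivity)
      _ = θ := by
          rw [hθ, hτ', rpow_neg (by positivity), mul_rpow hr.le hk'.le,
            mul_rpow two_pos.le hk'.le, div_rpow two_pos.le hr.le]
          field_simp
  have hxs2 : _root_.lpNorm 2 (restrictTo Vᶜ xs) ≤ θ := by
    have := lpNorm_restrictTo_tail_le hp0 hp1 hN0 (z := xs) (F := _root_.lpNorm 2) zero_le_one
      htwo0 lpNorm_two_add_le (fun u _ => (one_mul _).ge) hT₂S htop₂ hcard₂
    rw [hVc, one_mul] at this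
    exact this.trans hxsle
  have hxsA : _root_.lpNorm 2 (absMv A (restrictTo Vᶜ xs)) ≤ U * θ := by
    have := lpNorm_restrictTo_tail_le hp0 hp1 hN0 (z := xs)
      (F := fun u => _root_.lpNorm 2 (absMv A u)) hU.le hmeas0
      (lpNorm_absMv_add_le A) (hmeasU N hNM) hT₂S htop₂ hcard₂
    rw [hVc] at this
    exact this.trans (mul_le_mul_of_nonneg_left hxsle hU.le)
  -- the heads are close
  have hdiff : _root_.lpNorm 2 (fun i => absMv A xs i - absMv A x i) ≤ 2 * η := by
    have := lpNorm_two_add_le (fun i => absMv A xs i - (absMv A x i + e i)) e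
    have h : (fun i => absMv A xs i - (absMv A x i + e i) + e i)
        = fun i => absMv A xs i - absMv A x i := by ext i; ring
    rw [h] at this
    linarith
  have hheads : _root_.lpNorm 2
      (fun i => absMv A (restrictTo V xs) i - absMv A (restrictTo S x) i)
      ≤ U * θ + 2 * η + U * τ := by
    have h1 := lpNorm_absMv_sub_le A xs (restrictTo V xs)
    have h2 := lpNorm_absMv_sub_le A x (restrictTo S x)
    rw [show (fun j => xs j - restrictTo V xs j) = restrictTo Vᶜ xs by
      ext j; by_cases hj : j ∈ V <;> simp [restrictTo, hj]] at h1
    rw [show (fun j => x j - restrictTo S x j) = restrictTo Sᶜ x by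
      ext j; by_cases hj : j ∈ S <;> simp [restrictTo, hj]] at h2
    have h3 : _root_.lpNorm 2 (fun i => absMv A (restrictTo V xs) i - absMv A xs i)
        = _root_.lpNorm 2 (fun i => absMv A xs i - absMv A (restrictTo V xs) i) := by
      simp only [_root_.lpNorm, norm_sub_rev]
    have h4 := lpNorm_two_add_le (fun i => absMv A (restrictTo V xs) i - absMv A xs i)
      (fun i => absMv A xs i - absMv A x i)
    have h5 := lpNorm_two_add_le (fun i => (absMv A (restrictTo V xs) i - absMv A xs i)
      + (absMv A xs i - absMv A x i)) (fun i => absMv A x i - absMv A (restrictTo S x) i)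
    simp only [sub_add_sub_cancel] at h4 h5
    linarith
  have hlow : L * H ≤ U * θ + 2 * η + U * τ := by
    rw [hH]; exact ((hA _ hVmem _ hSmem).1).trans hheads
  have hHle : H ≤ C₂ * τ + D₂ * η := by
    have h1 : δ * H ≤ U * (Q / r ^ a + 1) * τ + 2 * η := by
      rw [hδdef, ← hQ, ← ha]
      rw [hθ] at hlow
      linarith
    rw [hC₂, hD₂, ← hQ, ← ha]
    calc H = δ * H / δ := by field_simp
      _ ≤ (U * (Q / r ^ a + 1) * τ + 2 * η) / δ := by gcongr
      _ = _ := by ring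
  have hfinal : phaseDist 2 xs x ≤ H + θ + τ := by
    refine (phaseDist_le 2 xs x hc).trans ?_
    have h1 := lpNorm_two_add_le (fun i => restrictTo V xs i - c * restrictTo S x i)
      (restrictTo Vᶜ xs)
    have h2 := lpNorm_two_add_le (fun i => restrictTo V xs i - c * restrictTo S x i
      + restrictTo Vᶜ xs i) (fun i => -(c * restrictTo Sᶜ x i))
    have h3 : _root_.lpNorm 2 (fun i => -(c * restrictTo Sᶜ x i))
        = _root_.lpNorm 2 (restrictTo Sᶜ x) := by
      simp only [_root_.lpNorm, norm_neg, norm_mul, hc, one_mul]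
    have h4 : (fun i => restrictTo V xs i - c * restrictTo S x i
        + restrictTo Vᶜ xs i + -(c * restrictTo Sᶜ x i)) = fun i => xs i - c * x i := by
      ext i
      by_cases hiV : i ∈ V <;> by_cases hiS : i ∈ S <;>
        simp only [restrictTo, Finset.mem_compl, hiV, hiS, not_true_eq_false, not_false_eq_true,
          if_true, if_false] <;> ring
    rw [h4] at h2
    rw [← hdist, ← hH] at h1
    linarith
  have hratio : Q / (r / 2) ^ a = Q * (2 / r) ^ a := by
    rw [div_rpow hr.le two_pos.le, div_rpow two_pos.le hr.le]
    field_simp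
  rw [← hQ, ← ha, ← hσdef, hratio, mul_div_assoc, ← hτ']
  have hfac : 0 ≤ 1 + Q * (2 / r) ^ a := by positivity
  calc phaseDist 2 xs x ≤ H + θ + τ := hfinal
    _ = (1 + Q * (2 / r) ^ a) * H + (Q / r ^ a + 1) * τ := by rw [hθ]; ring
    _ ≤ (1 + Q * (2 / r) ^ a) * (C₂ * τ + D₂ * η) + (Q / r ^ a + 1) * τ := by gcongr
    _ = _ := by ring
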